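/- Let U be an open subset of ℂ^(n+1) containing the origin, and let f : ℂ^(n+1) → ℂ be complex analytic on U with f(0) = 0. Then there exists an open neighborhood W of the origin, contained in U, such that for every z ∈ W at which the (complex Fréchet) derivative of f vanishes, one has f(z) = 0; that is, near the origin the critical locus Σf of f is contained in the hypersurface V(f) defined by f. -/

import Mathlib

open Topology Filter

namespace CritLocus

theorem functional_calculus {B : Type*} [NormedCommRing B] [NormedAlgebra ℂ B] [NormOneClass B]
    [CompleteSpace B] (n : ℕ) (h : (Fin n → ℂ) → ℂ) (hh : AnalyticAt ℂ h 0) :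
    ∃ H : (Fin n → B) → B, AnalyticAt ℂ H 0 ∧ ∀ᶠ b in 𝓝 (0 : Fin n → B),
      ∀ χ : B →ₐ[ℂ] ℂ, (∀ x, ‖χ x‖ ≤ ‖x‖) → χ (H b) = h (fun i => χ (b i)) := by
  obtain ⟨p, r, hp⟩ := hh
  let Q : FormalMultilinearSeries ℂ (Fin n → B) B := fun k =>
    ∑ i : Fin k → Fin n, (p k (fun j => Pi.single (i j) 1)) •
      (ContinuousMultilinearMap.mkPiAlgebra ℂ (Fin k) B).compContinuousLinearMap
        (fun j => ContinuousLinearMap.proj (i j))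
  have hQ : ∀ k (v : Fin k → Fin n → B), Q k v =
      ∑ i : Fin k → Fin n, (p k (fun j => Pi.single (i j) 1)) • ∏ j, v j (i j) := by
    intro k v
    simp [Q]
  have hnorm : ∀ k, ‖Q k‖ ≤ (n : ℝ) ^ k * ‖p k‖ := by
    intro k
    refine ContinuousMultilinearMap.opNorm_le_bound (by positivity) fun v => ?_
    rw [hQ]
    calc _ ≤ ∑ i : Fin k → Fin n, ‖p k‖ * ∏ j, ‖v j‖ := by
          refine norm_sum_le_of_le _ fun i _ => ?_
          rw [norm_smul]
          gcongr
          · refine ((p k).le_opNorm _).trans ?_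
            refine mul_le_of_le_one_right (norm_nonneg _) ?_
            refine Finset.prod_le_one (fun _ _ => norm_nonneg _) fun j _ => ?_
            refine (pi_norm_le_iff_of_nonneg zero_le_one).2 fun l => ?_
            by_cases hl : l = i j
            · subst hl; simp
            · simp [Pi.single_eq_of_ne hl]
          · refine (Finset.norm_prod_le _ _).trans ?_
            exact Finset.prod_le_prod (fun _ _ => norm_nonneg _) fun j _ => norm_le_pi_norm (v j) _
      _ = _ := by simp; ring
  obtain ⟨r', hr'0, hr'⟩ := ENNReal.lt_iff_exists_nnreal_btwn.1 hp.r_pos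
  have hr'0 : 0 < r' := by exact_mod_cast hr'0
  obtain ⟨C, hC0, hC⟩ := p.norm_mul_pow_le_of_lt_radius (hr'.trans_le hp.r_le)
  have hrad : 0 < Q.radius := by
    have : ((r' / (n + 1) : NNReal) : ENNReal) ≤ Q.radius := by
      refine Q.le_radius_of_bound C fun k => ?_
      calc ‖Q k‖ * ((r' / (n + 1) : NNReal) : ℝ) ^ k
          ≤ ((n + 1 : ℝ) ^ k * ‖p k‖) * (r' / (n + 1)) ^ k := by
            push_cast
            gcongr
            refine (hnorm k).trans ?_
            gcongr
            linarith
        _ = ‖p k‖ * r' ^ k := by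
            rw [div_pow]; field_simp
        _ ≤ C := hC k
    refine lt_of_lt_of_le ?_ this
    have : 0 < r' / (n + 1) := by positivity
    exact_mod_cast this
  have hF := Q.hasFPowerSeriesOnBall hrad
  refine ⟨Q.sum, hF.analyticAt, ?_⟩
  have e1 : ∀ᶠ b in 𝓝 (0 : Fin n → B), b ∈ Metric.eball 0 Q.radius := Metric.eball_mem_nhds _ hrad
  have e2 : ∀ᶠ b in 𝓝 (0 : Fin n → B), b ∈ Metric.ball 0 (r' : ℝ) :=
    Metric.ball_mem_nhds _ hr'0
  filter_upwards [e1, e2] with b hb1 hb2 χ hχ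
  let χ' : B →L[ℂ] ℂ := χ.toLinearMap.mkContinuous 1 (by simpa using hχ)
  have s1 := (hF.hasSum hb1).mapL χ'
  have hmem : (fun i => χ (b i)) ∈ Metric.eball (0 : Fin n → ℂ) r := by
    refine lt_trans ?_ hr'
    rw [edist_zero_right]
    have : ‖(fun i => χ (b i))‖ < r' := by
      rw [mem_ball_zero_iff] at hb2
      refine (pi_norm_lt_iff hr'0).2 fun i => (hχ _).trans_lt ((norm_le_pi_norm b i).trans_lt hb2)
    rw [← ofReal_norm, ENNReal.ofReal_lt_coe_iff]
    · exact this
    · positivity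
  have s2 := hp.hasSum hmem
  simp only [zero_add] at s1 s2
  suffices hfun : (fun k => χ' (Q k fun _ => b)) = fun k => p k fun _ i => χ (b i) by
    rw [hfun] at s1
    exact s1.unique s2
  funext k
  change χ (Q k fun _ => b) = _
  rw [hQ]
  have : (fun i => χ (b i)) = ∑ i, χ (b i) • (Pi.single i 1 : Fin n → ℂ) := by
    funext j; simp [Finset.sum_apply, Pi.single_apply]
  conv_rhs => rw [this]
  rw [ContinuousMultilinearMap.map_sum]
  simp only [map_sum, ContinuousMultilinearMap.map_smul_univ, map_smul, map_prod]
  refine Finset.sum_congr rfl fun i _ => ?_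
  simp [mul_comm]

/-- closed unit disc -/
abbrev Disc := Metric.closedBall (0 : ℂ) 1

instance : CompactSpace Disc := isCompact_iff_compactSpace.1 (isCompact_closedBall 0 1)

open Classical in
/-- extension by zero -/
noncomputable def ext (b : C(Disc, ℂ)) (z : ℂ) : ℂ :=
  if h : z ∈ Metric.closedBall (0 : ℂ) 1 then b ⟨z, h⟩ else 0

theorem ext_of_mem (b : C(Disc, ℂ)) {z : ℂ} (h : z ∈ Metric.closedBall (0 : ℂ) 1) :
    ext b z = b ⟨z, h⟩ := dif_pos h

theorem ext_of_mem_ball (b : C(Disc, ℂ)) {z : ℂ} (h : z ∈ Metric.ball (0 : ℂ) 1) :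
    ext b z = b ⟨z, Metric.ball_subset_closedBall h⟩ := dif_pos _

/-- The disc algebra. -/
noncomputable def discAlg : Subalgebra ℂ C(Disc, ℂ) where
  carrier := {b | DifferentiableOn ℂ (ext b) (Metric.ball 0 1)}
  mul_mem' {a b} ha hb := (ha.mul hb).congr fun z hz => by simp [ext_of_mem_ball _ hz]
  add_mem' {a b} ha hb := (ha.add hb).congr fun z hz => by simp [ext_of_mem_ball _ hz]
  algebraMap_mem' c := (differentiableOn_const c).congr fun z hz => by
    simp [ext_of_mem_ball _ hz]

theorem mem_discAlg {b : C(Disc, ℂ)} :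
    b ∈ discAlg ↔ DifferentiableOn ℂ (ext b) (Metric.ball 0 1) := Iff.rfl

theorem isClosed_discAlg : IsClosed (discAlg : Set C(Disc, ℂ)) := by
  refine IsSeqClosed.isClosed fun u b hu hb => ?_
  have hb' := ContinuousMap.tendsto_iff_tendstoUniformly.1 hb
  change DifferentiableOn ℂ (ext b) (Metric.ball 0 1)
  refine TendstoLocallyUniformlyOn.differentiableOn (F := fun n => ext (u n)) (φ := atTop) ?_
    (Eventually.of_forall fun n => hu n) Metric.isOpen_ball
  refine TendstoUniformlyOn.tendstoLocallyUniformlyOn ?_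
  rw [Metric.tendstoUniformlyOn_iff]
  intro ε hε
  filter_upwards [Metric.tendstoUniformly_iff.1 hb' ε hε] with n hn z hz
  simpa [ext_of_mem_ball _ hz] using hn _

instance : CompleteSpace discAlg := isClosed_discAlg.completeSpace_coe

noncomputable def ev (t : Disc) : discAlg →ₐ[ℂ] ℂ where
  toFun b := b.1 t
  map_one' := rfl
  map_mul' _ _ := rfl
  map_zero' := rfl
  map_add' _ _ := rfl
  commutes' _ := rfl

theorem ev_ext {a b : discAlg} (h : ∀ t, ev t a = ev t b) : a = b :=
  Subtype.ext (ContinuousMap.ext h)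

theorem norm_ev_le (t : Disc) (b : discAlg) : ‖ev t b‖ ≤ ‖b‖ := b.1.norm_coe_le_norm t

noncomputable def tau : discAlg :=
  ⟨⟨fun t => t.1, continuous_subtype_val⟩, differentiableOn_id.congr fun z hz => by
    simp [ext_of_mem_ball _ hz]⟩

@[simp] theorem ev_tau (t : Disc) : ev t tau = t.1 := rfl

/-- centre -/
def ctr : Disc := ⟨0, by simp⟩

theorem exists_div (b : discAlg) : ∃ c : discAlg, b = algebraMap ℂ _ (ev ctr b) + tau * c := by
  have hd : DifferentiableOn ℂ (dslope (ext b.1) 0) (Metric.ball 0 1) :=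
    (Complex.differentiableOn_dslope (Metric.ball_mem_nhds _ one_pos)).2 b.2
  have hc : Continuous fun t : Disc => dslope (ext b.1) 0 t.1 := by
    rw [continuous_iff_continuousAt]
    intro t
    by_cases ht : t.1 = 0
    · have h1 : ContinuousAt (dslope (ext b.1) 0) t.1 :=
        (hd.differentiableAt (by rw [ht]; exact Metric.ball_mem_nhds _ one_pos)).continuousAt
      exact ContinuousAt.comp (g := dslope (ext b.1) 0) h1 continuous_subtype_val.continuousAt
    · have h2 : ContinuousAt (fun s : Disc => (s.1)⁻¹ * (b.1 s - b.1 ctr)) t :=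
        (continuous_subtype_val.continuousAt.inv₀ ht).mul
          ((b.1.continuous.sub continuous_const).continuousAt)
      refine h2.congr ?_
      have : ∀ᶠ s : Disc in 𝓝 t, s.1 ≠ 0 :=
        continuous_subtype_val.continuousAt.eventually_ne ht
      filter_upwards [this] with s hs
      rw [dslope_of_ne _ hs, slope_def_module]
      simp [ext_of_mem _ s.2, ext_of_mem (z := 0) b.1 (by simp), ctr]
  refine ⟨⟨⟨_, hc⟩, hd.congr fun z hz => by simp [ext_of_mem_ball _ hz]⟩, ev_ext fun t => ?_⟩
  have key := sub_smul_dslope (ext b.1) 0 t.1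
  simp only [sub_zero, smul_eq_mul] at key
  change b.1 t = b.1 ctr + t.1 * dslope (ext b.1) 0 t.1
  rw [key, ext_of_mem _ t.2, ext_of_mem (z := 0) b.1 (by simp)]
  simp [ctr]

theorem tau_mul_cancel {b : discAlg} (h : tau * b = 0) : b = 0 := by
  have h0 : ∀ t : Disc, t.1 ≠ 0 → b.1 t = 0 := fun t ht => by
    have := congrArg (ev t) h
    rw [map_mul, map_zero, ev_tau, mul_eq_zero] at this
    exact this.resolve_left ht
  have hd : ∀ᶠ z in 𝓝[≠] (0:ℂ), ext b.1 z = 0 := by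
    filter_upwards [self_mem_nhdsWithin,
      mem_nhdsWithin_of_mem_nhds (Metric.ball_mem_nhds (0:ℂ) one_pos)] with z hz hz'
    rw [ext_of_mem_ball _ hz']
    exact h0 _ hz
  have hcont : ContinuousAt (ext b.1) 0 :=
    ((mem_discAlg.1 b.2).differentiableAt (Metric.ball_mem_nhds _ one_pos)).continuousAt
  have h00 : ext b.1 0 = 0 :=
    tendsto_nhds_unique (hcont.tendsto.mono_left nhdsWithin_le_nhds)
      (tendsto_const_nhds.congr' (hd.mono fun _ h => h.symm))
  refine ev_ext fun t => ?_
  by_cases ht : t.1 = 0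
  · have : t = ctr := Subtype.ext ht
    rw [this]
    rw [ext_of_mem _ (by simp)] at h00
    exact h00
  · exact h0 t ht

theorem exists_shift : ∃ S : discAlg →L[ℂ] discAlg,
    (∀ b, b = algebraMap ℂ _ (ev ctr b) + tau * S b) ∧ ∀ b, S (tau * b) = b := by
  let M : (ℂ × discAlg) →L[ℂ] discAlg :=
    (ContinuousLinearMap.toSpanSingleton ℂ (1 : discAlg)).comp (ContinuousLinearMap.fst ℂ _ _) +
      (ContinuousLinearMap.mul ℂ discAlg tau).comp (ContinuousLinearMap.snd ℂ _ _)
  have hM : ∀ c b, M (c, b) = algebraMap ℂ _ c + tau * b := by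
    intro c b; simp [M, Algebra.algebraMap_eq_smul_one]
  have inj : LinearMap.ker (M : (ℂ × discAlg) →ₗ[ℂ] discAlg) = ⊥ := by
    rw [LinearMap.ker_eq_bot']
    rintro ⟨c, b⟩ h
    have h : algebraMap ℂ discAlg c + tau * b = 0 := by rw [← hM]; exact h
    have hc : c = 0 := by
      have := congrArg (ev ctr) h
      simpa [ctr] using this
    subst hc
    simp only [map_zero, zero_add] at h
    simp [tau_mul_cancel h]
  have surj : LinearMap.range (M : (ℂ × discAlg) →ₗ[ℂ] discAlg) = ⊤ := by
    rw [LinearMap.range_eq_top]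
    intro b
    obtain ⟨c, hc⟩ := exists_div b
    exact ⟨(ev ctr b, c), by rw [hc]; simpa [ctr] using hM _ _⟩
  let e := ContinuousLinearEquiv.ofBijective M inj surj
  have he : ∀ b c, e.symm (algebraMap ℂ _ c + tau * b) = (c, b) := by
    intro b c
    rw [← hM, e.symm_apply_eq]; rfl
  refine ⟨(ContinuousLinearMap.snd ℂ _ _).comp e.symm.toContinuousLinearMap, fun b => ?_, fun b => ?_⟩
  · obtain ⟨c, hc⟩ := exists_div b
    have := he c (ev ctr b)
    rw [← hc] at this
    simp [this, ← hc]
  · have := he b 0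
    simp at this
    simp [this]


theorem analyticAt_clm_apply {E F G : Type*} [NormedAddCommGroup E] [NormedSpace ℂ E]
    [NormedAddCommGroup F] [NormedSpace ℂ F] [NormedAddCommGroup G] [NormedSpace ℂ G]
    {f : E → F →L[ℂ] G} {g : E → F} {x : E} (hf : AnalyticAt ℂ f x) (hg : AnalyticAt ℂ g x) :
    AnalyticAt ℂ (fun y => f y (g y)) x :=
  AnalyticAt.comp₂ (h := fun p : (F →L[ℂ] G) × F => p.1 p.2)
    (ContinuousLinearMap.analyticAt_bilinear (ContinuousLinearMap.id ℂ (F →L[ℂ] G)) _) hf hg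

section
variable {B : Type*} [NormedCommRing B] [NormedAlgebra ℂ B]

theorem shift_expand (S : B →L[ℂ] B) (τ : B) (e0 : B →L[ℂ] ℂ)
    (hS : ∀ b, b = algebraMap ℂ _ (e0 b) + τ * S b) (d : ℕ) (b : B) :
    b = (∑ j ∈ Finset.range d, e0 ((S ^ j) b) • τ ^ j) + τ ^ d * (S ^ d) b := by
  induction d with
  | zero => simp
  | succ d ih =>
    rw [Finset.sum_range_succ]
    conv_lhs => rw [ih]
    conv_lhs => rw [hS ((S ^ d) b)]
    rw [pow_succ' S, mul_apply_eq_comp, Algebra.algebraMap_eq_smul_one]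
    rw [mul_add, mul_smul_comm, mul_one]
    ring

theorem shift_pow (S : B →L[ℂ] B) (τ : B) (hS : ∀ b, S (τ * b) = b) (d : ℕ) :
    (S ^ d) (τ ^ d) = 1 := by
  induction d with
  | zero => simp
  | succ d ih => rw [pow_succ S, mul_apply_eq_comp, pow_succ', hS, ih]

theorem weierstrass_aux [NormOneClass B] [CompleteSpace B]
    (τ : B) (ev : Disc → B →ₐ[ℂ] ℂ) (ev_norm : ∀ t b, ‖ev t b‖ ≤ ‖b‖)
    (ev_ext : ∀ a b, (∀ t, ev t a = ev t b) → a = b) (ev_tau : ∀ t, ev t τ = t.1)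
    (S : B →L[ℂ] B) (hS1 : ∀ b, b = algebraMap ℂ _ (ev ctr b) + τ * S b)
    (hS2 : ∀ b, S (τ * b) = b)
    (n d : ℕ) (h : (Fin (n + 1) → ℂ) → ℂ) (hh : AnalyticAt ℂ h 0)
    (u0 : ℂ → ℂ) (hu0 : AnalyticAt ℂ u0 0) (hu00 : u0 0 ≠ 0)
    (hhu : ∀ᶠ t in 𝓝 (0 : ℂ), h (Fin.cons t 0) = t ^ d * u0 t)
    (g : (Fin (n + 1) → ℂ) → ℂ) (hg : AnalyticAt ℂ g 0) :
    ∃ (q : (Fin (n + 1) → ℂ) → ℂ) (r : ℕ → (Fin n → ℂ) → ℂ), AnalyticAt ℂ q 0 ∧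
      (∀ j, AnalyticAt ℂ (r j) 0) ∧
      (∀ᶠ z in 𝓝 (0 : Fin (n + 1) → ℂ),
        g z = q z * h z + ∑ j ∈ Finset.range d, r j (Fin.tail z) * z 0 ^ j) ∧
      ((∀ z, g z = z 0 ^ d) → q 0 ≠ 0) := by
  obtain ⟨H, hH, hHe⟩ := functional_calculus (B := B) (n + 1) h hh
  obtain ⟨G, hG, hGe⟩ := functional_calculus (B := B) (n + 1) g hg
  obtain ⟨W, hW, hWe⟩ := functional_calculus (B := B) 1 (fun z => (u0 (z 0))⁻¹)
    (by
      refine AnalyticAt.inv ?_ (by simpa using hu00)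
      refine AnalyticAt.fun_comp (g := u0) (f := fun z : Fin 1 → ℂ => z 0) (by simpa using hu0) ?_
      exact (ContinuousLinearMap.proj (R := ℂ) (φ := fun _ : Fin 1 => ℂ) 0).analyticAt _)
  -- choose the radius
  let i0 : ℝ → Fin (n + 1) → B := fun ρ => Fin.cons ((ρ : ℂ) • τ) (fun _ => 0)
  have hi0 : Tendsto i0 (𝓝 0) (𝓝 0) := by
    have : Continuous i0 := by
      refine continuous_pi fun i => ?_
      refine Fin.cases ?_ (fun j => ?_) i
      · simp only [i0, Fin.cons_zero]; fun_prop
      · simp only [i0, Fin.cons_succ]; fun_prop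
    have h2 := this.tendsto 0
    have h3 : i0 0 = 0 := by
      funext i
      refine Fin.cases ?_ (fun j => ?_) i <;> simp [i0]
    rwa [h3] at h2
  have hi1 : Tendsto (fun ρ : ℝ => fun _ : Fin 1 => (ρ : ℂ) • τ) (𝓝 0) (𝓝 0) := by
    have : Continuous (fun ρ : ℝ => fun _ : Fin 1 => (ρ : ℂ) • τ) := by fun_prop
    have h2 := this.tendsto 0
    have h3 : (fun _ : Fin 1 => ((0 : ℝ) : ℂ) • τ) = 0 := by funext i; simp
    rwa [h3] at h2
  have hu_ev : ∀ᶠ t in 𝓝 (0 : ℂ), h (Fin.cons t 0) = t ^ d * u0 t ∧ u0 t ≠ 0 :=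
    hhu.and (hu0.continuousAt.eventually_ne hu00)
  obtain ⟨δ, hδ, hδ'⟩ := Metric.eventually_nhds_iff_ball.1 hu_ev
  have E1 := hi0.eventually (hH.eventually_analyticAt.and (hHe.eventually_nhds))
  have E2 := hi0.eventually (hG.eventually_analyticAt.and (hGe.eventually_nhds))
  have E3 := hi1.eventually hWe
  have E4 : ∀ᶠ ρ in 𝓝 (0 : ℝ), ρ < δ := gt_mem_nhds hδ
  obtain ⟨ρ, ⟨⟨⟨hHa, hHb⟩, hGa, hGb⟩, hWb, hρδ⟩, hρ⟩ :=
    ((((E1.and E2).and (E3.and E4)).filter_mono nhdsWithin_le_nhds).and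
      (self_mem_nhdsWithin (s := Set.Ioi (0 : ℝ)))).exists
  have hρ : 0 < ρ := hρ
  have hρc : (ρ : ℂ) ≠ 0 := by exact_mod_cast hρ.ne'
  have hρt : ∀ t : Disc, (ρ : ℂ) * t.1 ∈ Metric.ball (0 : ℂ) δ := by
    intro t
    have := t.2
    rw [mem_closedBall_zero_iff] at this
    rw [mem_ball_zero_iff, norm_mul, Complex.norm_real, Real.norm_of_nonneg hρ.le]
    nlinarith
  let ι : (Fin n → ℂ) → Fin (n + 1) → B := fun x =>
    Fin.cons ((ρ : ℂ) • τ) (fun i => algebraMap ℂ B (x i))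
  have hι0 : ι 0 = i0 ρ := by
    funext i
    refine Fin.cases ?_ (fun j => ?_) i <;> simp [i0, ι]
  have hιa : AnalyticAt ℂ ι 0 := by
    refine AnalyticAt.pi fun i => ?_
    refine Fin.cases ?_ (fun j => ?_) i
    · simp only [ι, Fin.cons_zero]; exact analyticAt_const
    · simp only [ι, Fin.cons_succ]
      exact ((Algebra.linearMap ℂ B).toContinuousLinearMap.comp
        (ContinuousLinearMap.proj (R := ℂ) (φ := fun _ : Fin n => ℂ) j)).analyticAt _
  have hιc : Tendsto ι (𝓝 0) (𝓝 (i0 ρ)) := by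
    have := hιa.continuousAt.tendsto; rwa [hι0] at this
  have ev_rho : ∀ t : Disc, ev t ((ρ : ℂ) • τ) = (ρ : ℂ) * t.1 := by
    intro t
    rw [map_smul, ev_tau, smul_eq_mul]
  have ev_ι : ∀ (t : Disc) x, (fun i => ev t (ι x i)) = Fin.cons ((ρ : ℂ) * t.1) x := by
    intro t x
    funext i
    refine Fin.cases ?_ (fun j => ?_) i
    · exact ev_rho t
    · simp [ι]
  have hHι : ∀ᶠ x in 𝓝 (0 : Fin n → ℂ), ∀ t, ev t (H (ι x)) = h (Fin.cons ((ρ : ℂ) * t.1) x) := by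
    filter_upwards [hιc.eventually hHb] with x hx t
    rw [hx _ (ev_norm t), ev_ι]
  have hGι : ∀ᶠ x in 𝓝 (0 : Fin n → ℂ), ∀ t, ev t (G (ι x)) = g (Fin.cons ((ρ : ℂ) * t.1) x) := by
    filter_upwards [hιc.eventually hGb] with x hx t
    rw [hx _ (ev_norm t), ev_ι]
  let hx : (Fin n → ℂ) → B := fun x => H (ι x)
  let gx : (Fin n → ℂ) → B := fun x => G (ι x)
  have hhx : AnalyticAt ℂ hx 0 := AnalyticAt.fun_comp (by rwa [hι0]) hιa
  have hgx : AnalyticAt ℂ gx 0 := AnalyticAt.fun_comp (by rwa [hι0]) hιa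
  let w : B := ((ρ : ℂ) ^ d)⁻¹ • W (fun _ => (ρ : ℂ) • τ)
  have evw : ∀ t : Disc, ev t w = ((ρ : ℂ) ^ d)⁻¹ * (u0 (ρ * t.1))⁻¹ := by
    intro t
    simp only [w, map_smul, smul_eq_mul]
    rw [hWb _ (ev_norm t)]
    simp only [ev_rho]
  have hw : hx 0 * w = τ ^ d := by
    refine ev_ext _ _ fun t => ?_
    rw [map_mul, hHι.self_of_nhds t, evw, (hδ' _ (hρt t)).1, map_pow, ev_tau]
    have := (hδ' _ (hρt t)).2
    rw [mul_pow]
    field_simp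
  let e0 : B →L[ℂ] ℂ := (ev ctr).toLinearMap.mkContinuous 1
    (fun b => by rw [one_mul]; exact ev_norm ctr b)
  have he0 : ∀ b, e0 b = ev ctr b := fun _ => rfl
  let T : (Fin n → ℂ) → B →L[ℂ] B := fun x =>
    (∑ j ∈ Finset.range d, (ContinuousLinearMap.toSpanSingleton ℂ (τ ^ j)).comp (e0.comp (S ^ j))) +
      (ContinuousLinearMap.mul ℂ B (hx x * w)) * (S ^ d)
  have hT : ∀ x b, T x b = (∑ j ∈ Finset.range d, e0 ((S ^ j) b) • τ ^ j) +
      hx x * w * (S ^ d) b := by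
    intro x b
    simp [T]
  have hT0 : T 0 = 1 := by
    ext b
    rw [hT, hw, ← shift_expand S τ e0 hS1 d b]
    rfl
  have hTa : AnalyticAt ℂ T 0 := by
    refine analyticAt_const.add (AnalyticAt.mul ?_ analyticAt_const)
    exact ((ContinuousLinearMap.mul ℂ B).analyticAt _).fun_comp (hhx.mul analyticAt_const)
  let c : (Fin n → ℂ) → B := fun x => Ring.inverse (T x) (gx x)
  have hc : AnalyticAt ℂ c 0 := by
    refine analyticAt_clm_apply ?_ hgx
    refine AnalyticAt.fun_comp (g := Ring.inverse) ?_ hTa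
    rw [hT0]
    exact analyticAt_inverse (1 : (B →L[ℂ] B)ˣ)
  have hunit : ∀ᶠ x in 𝓝 (0 : Fin n → ℂ), IsUnit (T x) := by
    refine hTa.continuousAt.eventually (Units.isOpen.mem_nhds ?_)
    simp [hT0]
  have hTc : ∀ᶠ x in 𝓝 (0 : Fin n → ℂ), T x (c x) = gx x := by
    filter_upwards [hunit] with x hx
    change (T x * Ring.inverse (T x)) (gx x) = gx x
    rw [Ring.mul_inverse_cancel _ hx]
    rfl
  let qB : (Fin n → ℂ) → B := fun x => w * (S ^ d) (c x)
  have hqB : AnalyticAt ℂ qB 0 :=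
    analyticAt_const.mul (((S ^ d).analyticAt _).fun_comp hc)
  -- the evaluation operators
  let Ev : ℂ → B →L[ℂ] ℂ := fun t => e0.comp (Ring.inverse (1 - t • S))
  have h1S : AnalyticAt ℂ (fun t : ℂ => 1 - t • S) 0 := by fun_prop
  have h10 : (fun t : ℂ => 1 - t • S) 0 = 1 := by
    ext b
    change b - (0 : ℂ) • S b = b
    rw [zero_smul, sub_zero]
  have hEv : AnalyticAt ℂ Ev 0 := by
    have h1 : AnalyticAt ℂ (fun t : ℂ => Ring.inverse (1 - t • S)) 0 := by
      refine AnalyticAt.fun_comp (g := Ring.inverse) ?_ h1S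
      change AnalyticAt ℂ Ring.inverse ((fun t : ℂ => 1 - t • S) 0)
      rw [h10]
      exact analyticAt_inverse (1 : (B →L[ℂ] B)ˣ)
    exact ((ContinuousLinearMap.compL ℂ B B ℂ e0).analyticAt _).fun_comp h1
  have hEv_eq : ∀ᶠ t in 𝓝 (0 : ℂ), ∀ ht : t ∈ Metric.closedBall (0 : ℂ) 1, ∀ b,
      Ev t b = ev ⟨t, ht⟩ b := by
    have : ∀ᶠ t in 𝓝 (0 : ℂ), IsUnit (1 - t • S) := by
      refine h1S.continuousAt.eventually (Units.isOpen.mem_nhds ?_)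
      change IsUnit ((fun t : ℂ => 1 - t • S) 0)
      rw [h10]
      exact isUnit_one
    filter_upwards [this] with t htu ht b
    have key : ∀ b', ev ⟨t, ht⟩ ((1 - t • S) b') = e0 b' := by
      intro b'
      have h1 := congrArg (ev ⟨t, ht⟩) (hS1 b')
      simp only [map_add, map_mul, ev_tau, AlgHom.commutes] at h1
      simp only [sub_apply, one_apply_eq_self, map_sub,
        smul_apply, map_smul, smul_eq_mul, he0]
      rw [h1]; simp
    change e0 (Ring.inverse (1 - t • S) b) = _
    rw [← key]
    change ev _ (((1 - t • S) * Ring.inverse (1 - t • S)) b) = _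
    rw [Ring.mul_inverse_cancel _ htu]
    rfl
  have htail : AnalyticAt ℂ (fun z : Fin (n + 1) → ℂ => Fin.tail z) 0 := by
    refine AnalyticAt.pi fun i => ?_
    exact (ContinuousLinearMap.proj (R := ℂ) (φ := fun _ : Fin (n + 1) => ℂ) i.succ).analyticAt _
  have htail0 : Fin.tail (0 : Fin (n + 1) → ℂ) = 0 := rfl
  have hz0 : AnalyticAt ℂ (fun z : Fin (n + 1) → ℂ => z 0 / ρ) 0 := by
    refine AnalyticAt.div ?_ analyticAt_const hρc
    exact (ContinuousLinearMap.proj (R := ℂ) (φ := fun _ : Fin (n + 1) => ℂ) 0).analyticAt _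
  have hz00 : (0 : Fin (n + 1) → ℂ) 0 / (ρ : ℂ) = 0 := by simp
  have ctail : Tendsto (fun z : Fin (n + 1) → ℂ => Fin.tail z) (𝓝 0) (𝓝 0) :=
    htail.continuousAt
  have cz0 : Tendsto (fun z : Fin (n + 1) → ℂ => z 0 / ρ) (𝓝 0) (𝓝 0) := by
    have := hz0.continuousAt.tendsto
    rwa [hz00] at this
  refine ⟨fun z => Ev (z 0 / ρ) (qB (Fin.tail z)), fun j x => e0 ((S ^ j) (c x)) * ((ρ : ℂ) ^ j)⁻¹,
    ?_, ?_, ?_, ?_⟩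
  · refine analyticAt_clm_apply ?_ ?_
    · exact AnalyticAt.fun_comp (g := Ev) (by rw [hz00]; exact hEv) hz0
    · exact AnalyticAt.fun_comp (g := qB) hqB htail
  · intro j
    exact (((e0.comp (S ^ j)).analyticAt _).fun_comp hc).mul analyticAt_const
  · have hball : ∀ᶠ t in 𝓝 (0 : ℂ), t ∈ Metric.closedBall (0 : ℂ) 1 :=
      Metric.closedBall_mem_nhds _ one_pos
    filter_upwards [ctail.eventually hTc, ctail.eventually hHι, ctail.eventually hGι,
      cz0.eventually hEv_eq, cz0.eventually hball] with z h1 h2 h3 h4 h5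
    have hzz : (Fin.cons ((ρ : ℂ) * (z 0 / ρ)) (Fin.tail z) : Fin (n + 1) → ℂ) = z := by
      rw [mul_div_cancel₀ _ hρc]; exact Fin.cons_self_tail z
    have h3' := h3 ⟨_, h5⟩
    have h2' := h2 ⟨_, h5⟩
    simp only [hzz] at h2' h3'
    rw [h4 h5, ← h3', ← h2']
    change ev _ (gx _) = ev _ _ * ev _ (hx _) + _
    rw [← h1, hT, map_add, map_sum, add_comm]
    congr 1
    · rw [← map_mul]; congr 1; simp only [qB]; ring
    · refine Finset.sum_congr rfl fun j _ => ?_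
      simp only [map_smul, map_pow, ev_tau, smul_eq_mul, div_pow]
      ring
  · intro hgz
    have hc0 : c 0 = ((ρ : ℂ) ^ d) • τ ^ d := by
      have := hTc.self_of_nhds
      rw [hT0] at this
      change c 0 = gx 0 at this
      rw [this]
      refine ev_ext _ _ fun t => ?_
      rw [hGι.self_of_nhds t, hgz]
      simp [ev_tau, mul_pow]
    have h0 : (0 : ℂ) ∈ Metric.closedBall (0 : ℂ) 1 := by simp
    simp only [hz00, htail0]
    rw [hEv_eq.self_of_nhds h0]
    simp only [qB, hc0, map_smul, shift_pow S τ hS2 d, map_mul, evw, map_one, smul_eq_mul]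
    simp [hu00, hρc]

end

theorem exists_model : ∃ (B : Type) (_ : NormedCommRing B) (_ : NormedAlgebra ℂ B)
    (_ : NormOneClass B) (_ : CompleteSpace B)
    (τ : B) (ev : Disc → B →ₐ[ℂ] ℂ) (S : B →L[ℂ] B),
    (∀ t b, ‖ev t b‖ ≤ ‖b‖) ∧ (∀ a b, (∀ t, ev t a = ev t b) → a = b) ∧ (∀ t, ev t τ = t.1) ∧
    (∀ b, b = algebraMap ℂ _ (ev ctr b) + τ * S b) ∧ (∀ b, S (τ * b) = b) := by
  obtain ⟨S, hS1, hS2⟩ := exists_shift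
  exact ⟨discAlg, inferInstance, inferInstance, ⟨by
    change ‖(1 : C(Disc, ℂ))‖ = 1
    exact norm_one⟩, inferInstance, tau, ev, S, norm_ev_le,
    fun a b => ev_ext, ev_tau, hS1, hS2⟩

theorem weierstrass (n : ℕ) (h : (Fin (n + 1) → ℂ) → ℂ) (hh : AnalyticAt ℂ h 0)
    (hne : ¬ ∀ᶠ t in 𝓝 (0 : ℂ), h (Fin.cons t 0) = 0) : ∃ d : ℕ,
    ∀ (g : (Fin (n + 1) → ℂ) → ℂ), AnalyticAt ℂ g 0 →
    ∃ (q : (Fin (n + 1) → ℂ) → ℂ) (r : ℕ → (Fin n → ℂ) → ℂ), AnalyticAt ℂ q 0 ∧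
      (∀ j, AnalyticAt ℂ (r j) 0) ∧
      (∀ᶠ z in 𝓝 (0 : Fin (n + 1) → ℂ),
        g z = q z * h z + ∑ j ∈ Finset.range d, r j (Fin.tail z) * z 0 ^ j) ∧
      ((∀ z, g z = z 0 ^ d) → q 0 ≠ 0) := by
  have hcons : AnalyticAt ℂ (fun t : ℂ => (Fin.cons t 0 : Fin (n + 1) → ℂ)) 0 := by
    refine AnalyticAt.pi fun i => ?_
    refine Fin.cases ?_ (fun j => ?_) i
    · simp only [Fin.cons_zero]; exact analyticAt_id
    · simp only [Fin.cons_succ]; exact analyticAt_const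
  have hcons0 : (Fin.cons 0 0 : Fin (n + 1) → ℂ) = 0 := by
    funext i
    refine Fin.cases ?_ (fun j => ?_) i <;> simp
  have ha : AnalyticAt ℂ (fun t : ℂ => h (Fin.cons t 0)) 0 :=
    AnalyticAt.fun_comp (g := h) (by rw [hcons0]; exact hh) hcons
  obtain ⟨d, u0, hu0, hu00, hu⟩ := ha.exists_eventuallyEq_pow_smul_nonzero_iff.2 hne
  obtain ⟨B, _, _, _, _, τ, ev, S, h1, h2, h3, hS1, hS2⟩ := exists_model
  refine ⟨d, fun g hg => ?_⟩
  exact weierstrass_aux τ ev h1 h2 h3 S hS1 hS2 n d h hh u0 hu0 hu00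
    (by simpa using hu) g hg


section
open scoped TensorProduct
open KaehlerDifferential
theorem extend_der {k A T : Type*} [CommRing k] [CommRing A] [CommRing T] [Algebra k A]
    [Algebra k T] [Algebra A T] [IsScalarTower k A T] [Algebra.FormallyEtale A T]
    (δ : Derivation k A T) : ∃ D : Derivation k T T, ∀ x, D (algebraMap A T x) = δ x := by
  let e := (KaehlerDifferential.tensorKaehlerEquivOfFormallyEtale k A T).symm
  let g : TensorProduct A T (Ω[A⁄k]) →ₗ[T] T :=
    LinearMap.liftBaseChange T δ.liftKaehlerDifferential
  refine ⟨(g ∘ₗ e.toLinearMap).compDer (KaehlerDifferential.D k T), fun x => ?_⟩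
  have : e (KaehlerDifferential.D k T (algebraMap A T x)) = 1 ⊗ₜ KaehlerDifferential.D k A x :=
    KaehlerDifferential.tensorKaehlerEquivOfFormallyEtale_symm_D_algebraMap k A T x
  change g (e (KaehlerDifferential.D k T (algebraMap A T x))) = δ x
  rw [this]
  simp [g]

theorem extend_der' {k A T : Type*} [CommRing k] [CommRing A] [CommRing T] [Algebra k A]
    [Algebra k T] [Algebra A T] [IsScalarTower k A T] [Algebra.FormallyEtale A T]
    (δ : Derivation k A A) : ∃ D : Derivation k T T,
      ∀ x, D (algebraMap A T x) = algebraMap A T (δ x) := by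
  obtain ⟨D, hD⟩ := extend_der (T := T) ((Algebra.linearMap A T).compDer δ)
  exact ⟨D, fun x => by rw [hD]; rfl⟩

theorem minpoly_coeff {K L : Type*} [Field K] [Field L] [Algebra ℂ K] [Algebra ℂ L]
    [Algebra K L] [IsScalarTower ℂ K L] (a : L) (ha : IsIntegral K a)
    (δ : Derivation ℂ K K) (D : Derivation ℂ L L)
    (hD : ∀ x, D (algebraMap K L x) = algebraMap K L (δ x)) (hDa : D a = 0) (i : ℕ) :
    δ ((minpoly K a).coeff i) = 0 := by
  set p := minpoly K a with hp
  have h1 : Polynomial.aeval a p = 0 := minpoly.aeval K a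
  let Q : Polynomial K := ∑ j ∈ Finset.range p.natDegree, Polynomial.monomial j (δ (p.coeff j))
  have hlead : δ (p.coeff p.natDegree) = 0 := by
    have : p.coeff p.natDegree = 1 := minpoly.monic ha
    rw [this]; simp
  have h2 : Polynomial.aeval a Q = 0 := by
    rw [Polynomial.aeval_eq_sum_range] at h1
    have h3 := congrArg D h1
    rw [map_sum, map_zero, Finset.sum_range_succ] at h3
    have key : ∀ j, D (p.coeff j • a ^ j) = algebraMap K L (δ (p.coeff j)) * a ^ j := fun j => by
      rw [Algebra.smul_def, Derivation.leibniz, Derivation.leibniz_pow, hDa, hD]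
      simp [mul_comm]
    simp only [key, hlead, map_zero, zero_mul, add_zero] at h3
    rw [← h3]
    simp only [Q, map_sum, Polynomial.aeval_monomial]
  have hQ : Q = 0 := by
    by_contra hne
    have hlt : Q.degree < p.degree := by
      rw [Polynomial.degree_eq_natDegree (minpoly.ne_zero ha)]
      refine (Polynomial.degree_sum_le _ _).trans_lt ?_
      rw [Finset.sup_lt_iff (WithBot.bot_lt_coe _)]
      intro j hj
      refine (Polynomial.degree_monomial_le _ _).trans_lt ?_
      exact_mod_cast Finset.mem_range.1 hj
    exact absurd (minpoly.degree_le_of_ne_zero K a hne h2) (not_le.2 hlt)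
  rcases lt_trichotomy i p.natDegree with h | h | h
  · have := congrArg (fun q => Polynomial.coeff q i) hQ
    simpa [Q, Polynomial.finsetSum_coeff, Polynomial.coeff_monomial, h] using this
  · rw [h, hlead]
  · rw [Polynomial.coeff_eq_zero_of_natDegree_lt h, map_zero]

theorem const_of_der {ι A L : Type*} (K : Type*) [CommRing A] [IsDomain A] [Algebra ℂ A]
    [Field K] [Algebra ℂ K] [Field L] [Algebra ℂ L] [Algebra A K] [Algebra A L] [Algebra K L]
    [IsScalarTower ℂ A K] [IsScalarTower ℂ A L] [IsScalarTower ℂ K L] [IsScalarTower A K L]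
    [IsFractionRing A K] [Algebra.IsAlgebraic K L]
    (δ : ι → Derivation ℂ A A)
    (hconst : ∀ u v : A, v ≠ 0 → (∀ i, δ i u * v = u * δ i v) → ∃ c : ℂ, u = algebraMap ℂ A c * v)
    (a : L) (ha : ∀ i (D : Derivation ℂ L L),
      (∀ x, D (algebraMap A L x) = algebraMap A L (δ i x)) → D a = 0) :
    ∃ c : ℂ, a = algebraMap ℂ L c := by
  have : Algebra.FormallyEtale A K := Algebra.FormallyEtale.of_isLocalization (nonZeroDivisors A)
  have : CharZero K := charZero_of_injective_algebraMap (algebraMap ℂ K).injective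
  have : Algebra.FormallyEtale K L := Algebra.FormallyEtale.of_isSeparable K L
  have hInteg : IsIntegral K a := Algebra.IsIntegral.isIntegral a
  choose δK hδK using fun i => extend_der' (T := K) (δ i)
  choose D hD using fun i => extend_der' (T := L) (δK i)
  have hz : ∀ i m, δK i ((minpoly K a).coeff m) = 0 := fun i m =>
    minpoly_coeff a hInteg (δK i) (D i) (hD i) (ha i (D i) fun x => by
      rw [IsScalarTower.algebraMap_apply A K L, hD, hδK, ← IsScalarTower.algebraMap_apply A K L]) m
  have hc : ∀ m, ∃ c : ℂ, (minpoly K a).coeff m = algebraMap ℂ K c := by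
    intro m
    obtain ⟨u, v, hv, huv⟩ := IsFractionRing.div_surjective (A := A) ((minpoly K a).coeff m)
    have hv0 : v ≠ 0 := nonZeroDivisors.ne_zero hv
    have hvK : algebraMap A K v ≠ 0 := fun h => hv0 ((IsFractionRing.injective A K) (by simpa using h))
    obtain ⟨c, hc⟩ := hconst u v hv0 fun i => by
      apply IsFractionRing.injective A K
      have hu : algebraMap A K u = (minpoly K a).coeff m * algebraMap A K v := by
        rw [← huv]; field_simp
      have := congrArg (δK i) hu
      rw [hδK, Derivation.leibniz, hz, hδK, smul_zero, add_zero, smul_eq_mul] at this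
      rw [map_mul, map_mul, this, hu]; ring
    refine ⟨c, ?_⟩
    rw [← huv, hc, map_mul, ← IsScalarTower.algebraMap_apply ℂ A K]
    field_simp
  choose c hc using hc
  have hIn : IsIntegral ℂ a := by
    have hlift : minpoly K a ∈ Polynomial.lifts (algebraMap ℂ K) := by
      rw [Polynomial.lifts_iff_coeff_lifts]
      exact fun m => ⟨c m, (hc m).symm⟩
    obtain ⟨q, hq, -, hqm⟩ := Polynomial.lifts_and_degree_eq_and_monic hlift (minpoly.monic hInteg)
    refine ⟨q, hqm, ?_⟩
    rw [← Polynomial.aeval_def, ← Polynomial.aeval_map_algebraMap K, hq, minpoly.aeval]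
  have hdeg := IsAlgClosed.degree_eq_one_of_irreducible ℂ (minpoly.irreducible hIn)
  obtain ⟨x, hx⟩ := minpoly.mem_range_of_degree_eq_one ℂ a hdeg
  exact ⟨x, hx.symm⟩
end

/-- functions analytic at the origin -/
def R (n : ℕ) : Subalgebra ℂ ((Fin n → ℂ) → ℂ) where
  carrier := {f | AnalyticAt ℂ f 0}
  mul_mem' := fun ha hb => AnalyticAt.mul ha hb
  add_mem' := fun ha hb => AnalyticAt.add ha hb
  algebraMap_mem' := fun _ => analyticAt_const

theorem R_mem {n : ℕ} (g : R n) : AnalyticAt ℂ g.1 0 := g.2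

/-- partial derivative -/
noncomputable def pd {n : ℕ} (i : Fin n) (g : R n) : R n :=
  ⟨fun z => fderiv ℂ g.1 z (Pi.single i 1), by
    have := (R_mem g).fderiv
    exact ((ContinuousLinearMap.apply ℂ ℂ (Pi.single i (1 : ℂ) : Fin n → ℂ)).analyticAt _).comp
      this⟩

/-- coordinate function -/
def coord {n : ℕ} (i : Fin n) : R n :=
  ⟨fun z => z i, (ContinuousLinearMap.proj (R := ℂ) (φ := fun _ : Fin n => ℂ) i).analyticAt 0⟩

/-- substitution of a continuous linear map -/
noncomputable def lsub {m n : ℕ} (T : (Fin m → ℂ) →L[ℂ] (Fin n → ℂ)) : R n →ₐ[ℂ] R m where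
  toFun g := ⟨fun z => g.1 (T z), by
    refine AnalyticAt.fun_comp (g := g.1) ?_ (T.analyticAt 0)
    rw [map_zero]; exact R_mem g⟩
  map_one' := rfl
  map_mul' _ _ := rfl
  map_zero' := rfl
  map_add' _ _ := rfl
  commutes' _ := rfl

theorem diffAt {n : ℕ} (g : R n) : ∀ᶠ z in 𝓝 (0 : Fin n → ℂ), DifferentiableAt ℂ g.1 z :=
  (R_mem g).eventually_analyticAt.mono fun _ h => h.differentiableAt

theorem pd_add {n : ℕ} (i : Fin n) (g h : R n) :
    ∀ᶠ z in 𝓝 (0 : Fin n → ℂ), (pd i (g + h)).1 z = (pd i g + pd i h).1 z := by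
  filter_upwards [diffAt g, diffAt h] with z hg hh
  change fderiv ℂ (g.1 + h.1) z _ = fderiv ℂ g.1 z _ + fderiv ℂ h.1 z _
  rw [fderiv_add hg hh]; rfl

theorem pd_mul {n : ℕ} (i : Fin n) (g h : R n) :
    ∀ᶠ z in 𝓝 (0 : Fin n → ℂ), (pd i (g * h)).1 z = (g * pd i h + h * pd i g).1 z := by
  filter_upwards [diffAt g, diffAt h] with z hg hh
  change fderiv ℂ (g.1 * h.1) z _ = g.1 z * fderiv ℂ h.1 z _ + h.1 z * fderiv ℂ g.1 z _
  rw [fderiv_mul hg hh]; rfl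

theorem pd_smul {n : ℕ} (i : Fin n) (c : ℂ) (g : R n) :
    ∀ᶠ z in 𝓝 (0 : Fin n → ℂ), (pd i (c • g)).1 z = (c • pd i g).1 z := by
  filter_upwards [diffAt g] with z hg
  change fderiv ℂ (c • g.1) z _ = c • fderiv ℂ g.1 z _
  rw [fderiv_const_smul hg]; rfl

theorem pd_const {n : ℕ} (i : Fin n) (c : ℂ) : pd i (algebraMap ℂ (R n) c) = 0 := by
  ext z
  change fderiv ℂ (fun _ => c) z _ = 0
  simp

theorem pd_coord {n : ℕ} (i j : Fin n) : pd i (coord j) = if j = i then 1 else 0 := by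
  ext z
  change fderiv ℂ (ContinuousLinearMap.proj (R := ℂ) (φ := fun _ : Fin n => ℂ) j) z _ = _
  rw [ContinuousLinearMap.fderiv]
  by_cases h : j = i
  · subst h; simp
  · simp [h]

theorem pd_congr {n : ℕ} (i : Fin n) (g h : R n) (e : ∀ᶠ z in 𝓝 (0 : Fin n → ℂ), g.1 z = h.1 z) :
    ∀ᶠ z in 𝓝 (0 : Fin n → ℂ), (pd i g).1 z = (pd i h).1 z := by
  have : g.1 =ᶠ[𝓝 0] h.1 := e
  filter_upwards [this.fderiv (𝕜 := ℂ)] with z hz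
  change fderiv ℂ g.1 z _ = fderiv ℂ h.1 z _
  rw [hz]

theorem fderiv_expand {m : ℕ} (l : (Fin m → ℂ) →L[ℂ] ℂ) (w : Fin m → ℂ) :
    l w = ∑ j, w j * l (Pi.single j 1) := by
  conv_lhs => rw [pi_eq_sum_univ' w]
  rw [map_sum]
  refine Finset.sum_congr rfl fun j _ => ?_
  rw [map_smul, smul_eq_mul]

theorem pd_lsub {m n : ℕ} (T : (Fin m → ℂ) →L[ℂ] (Fin n → ℂ)) (i : Fin m) (g : R n) :
    ∀ᶠ z in 𝓝 (0 : Fin m → ℂ), (pd i (lsub T g)).1 z =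
      (∑ j, (T (Pi.single i 1) j) • lsub T (pd j g)).1 z := by
  have ht : Tendsto T (𝓝 0) (𝓝 0) := by simpa using T.continuous.tendsto 0
  filter_upwards [ht.eventually (diffAt g)] with z hz
  have h1 : (pd i (lsub T g)).1 z = fderiv ℂ g.1 (T z) (T (Pi.single i 1)) := by
    change fderiv ℂ (g.1 ∘ T) z _ = _
    rw [fderiv_comp z hz T.differentiableAt, T.fderiv]; rfl
  rw [h1, fderiv_expand]
  simp
  rfl

/-- `φ` factors through germs -/
def Germy {n : ℕ} {L : Type*} [Field L] [Algebra ℂ L] (φ : R n →ₐ[ℂ] L) : Prop :=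
  ∀ g : R n, (∀ᶠ z in 𝓝 (0 : Fin n → ℂ), g.1 z = 0) → φ g = 0

section
variable {n : ℕ} {L : Type*} [Field L] [Algebra ℂ L]

theorem Germy.congr {φ : R n →ₐ[ℂ] L} (hφ : Germy φ) {g h : R n}
    (e : ∀ᶠ z in 𝓝 (0 : Fin n → ℂ), g.1 z = h.1 z) : φ g = φ h := by
  rw [← sub_eq_zero, ← map_sub]
  apply hφ
  filter_upwards [e] with z hz
  change g.1 z - h.1 z = 0
  rw [hz, sub_self]

/-- compatibility of a derivation with the chain rule -/
def IsDer (φ : R n →ₐ[ℂ] L) (D : Derivation ℂ L L) : Prop :=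
  ∀ g, D (φ g) = ∑ i, φ (pd i g) * D (φ (coord i))

theorem Germy.ne_zero {φ : R n →ₐ[ℂ] L} (hφ : Germy φ) (h : R n) (h0 : h.1 0 ≠ 0) : φ h ≠ 0 := by
  intro hh
  let k : R n := ⟨fun z => (h.1 z)⁻¹, (R_mem h).inv h0⟩
  have : φ (h * k) = φ 1 := hφ.congr (by
    filter_upwards [(R_mem h).continuousAt.eventually_ne h0] with z hz
    change h.1 z * (h.1 z)⁻¹ = 1
    exact mul_inv_cancel₀ hz)
  rw [map_mul, hh, zero_mul, map_one] at this
  exact zero_ne_one this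

end

theorem germ_const {n : ℕ} (u v : R n) (hv : ¬ ∀ᶠ z in 𝓝 (0 : Fin n → ℂ), v.1 z = 0)
    (h : ∀ i, ∀ᶠ z in 𝓝 (0 : Fin n → ℂ), (pd i u * v).1 z = (u * pd i v).1 z) :
    ∃ c : ℂ, ∀ᶠ z in 𝓝 (0 : Fin n → ℂ), u.1 z = c * v.1 z := by
  have hall := ((eventually_all.2 h).and ((R_mem u).eventually_analyticAt.and
    (R_mem v).eventually_analyticAt))
  obtain ⟨r, hr, hB⟩ := Metric.eventually_nhds_iff_ball.1 hall
  have hfr : ∃ᶠ z in 𝓝 (0 : Fin n → ℂ), v.1 z ≠ 0 := not_eventually.1 hv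
  obtain ⟨p, hp, hpB⟩ := (hfr.and_eventually (Metric.ball_mem_nhds 0 hr)).exists
  have hev : ∀ᶠ z in 𝓝 p, v.1 z ≠ 0 ∧ z ∈ Metric.ball (0 : Fin n → ℂ) r :=
    ((hB p hpB).2.2.continuousAt.eventually_ne hp).and (Metric.isOpen_ball.mem_nhds hpB)
  obtain ⟨s, hs, hS⟩ := Metric.eventually_nhds_iff_ball.1 hev
  have hd : ∀ z ∈ Metric.ball p s, HasFDerivAt (fun z => u.1 z * (v.1 z)⁻¹) (0 : (Fin n → ℂ) →L[ℂ] ℂ) z := by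
    intro z hz
    obtain ⟨hvz, hzB⟩ := hS z hz
    obtain ⟨he, hu, hvv⟩ := hB z hzB
    have h1 := hu.differentiableAt.hasFDerivAt.mul 
      ((hasDerivAt_inv hvz).comp_hasFDerivAt z hvv.differentiableAt.hasFDerivAt)
    convert! h1 using 1
    symm
    ext w
    have hlin : ∀ w, fderiv ℂ u.1 z w * v.1 z = u.1 z * fderiv ℂ v.1 z w := by
      intro w
      rw [fderiv_expand (fderiv ℂ u.1 z), fderiv_expand (fderiv ℂ v.1 z), Finset.sum_mul,
        Finset.mul_sum]
      refine Finset.sum_congr rfl fun j _ => ?_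
      have := he j
      change fderiv ℂ u.1 z (Pi.single j 1) * v.1 z = u.1 z * fderiv ℂ v.1 z (Pi.single j 1) at this
      linear_combination (w j) * this
    have := hlin w
    simp
    field_simp
    linear_combination this
  have hconst : ∀ z ∈ Metric.ball p s, u.1 z * (v.1 z)⁻¹ = u.1 p * (v.1 p)⁻¹ := by
    intro z hz
    refine (convex_ball p s).is_const_of_fderivWithin_eq_zero (𝕜 := ℂ)
      (f := fun z => u.1 z * (v.1 z)⁻¹)
      (fun y hy => (hd y hy).differentiableAt.differentiableWithinAt)
      (fun y hy => ?_) hz (Metric.mem_ball_self hs)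
    exact (hd y hy).hasFDerivWithinAt.fderivWithin (Metric.isOpen_ball.uniqueDiffWithinAt hy)
  refine ⟨u.1 p * (v.1 p)⁻¹, ?_⟩
  have hanu : AnalyticOnNhd ℂ u.1 (Metric.ball 0 r) := fun z hz => (hB z hz).2.1
  have hanv : AnalyticOnNhd ℂ (fun z => (u.1 p * (v.1 p)⁻¹) * v.1 z) (Metric.ball 0 r) :=
    fun z hz => analyticAt_const.mul (hB z hz).2.2
  have hEq := hanu.eqOn_of_preconnected_of_eventuallyEq hanv (convex_ball 0 r).isPreconnected hpB
    (by
      filter_upwards [Metric.ball_mem_nhds p hs] with z hz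
      rw [← hconst z hz]
      have := (hS z hz).1
      field_simp)
  filter_upwards [Metric.ball_mem_nhds 0 hr] with z hz using hEq hz

section
variable {n : ℕ} {L : Type*} [Field L] [Algebra ℂ L]

theorem exists_delta (φ : R n →ₐ[ℂ] L) (hφ : Germy φ)
    (hker : ∀ g : R n, φ g = 0 → ∀ᶠ z in 𝓝 (0 : Fin n → ℂ), g.1 z = 0) (i : Fin n) :
    ∃ δ : Derivation ℂ φ.range φ.range, ∀ g, δ (φ.rangeRestrict g) = φ.rangeRestrict (pd i g) := by
  have hs : Function.Surjective φ.rangeRestrict := φ.rangeRestrict_surjective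
  choose s hs using hs
  have hc : ∀ g h : R n, (∀ᶠ z in 𝓝 (0 : Fin n → ℂ), g.1 z = h.1 z) →
      φ.rangeRestrict g = φ.rangeRestrict h := fun g h e => Subtype.ext (hφ.congr e)
  have key : ∀ g h : R n, φ.rangeRestrict g = φ.rangeRestrict h →
      φ.rangeRestrict (pd i g) = φ.rangeRestrict (pd i h) := by
    intro g h e
    refine hc _ _ (pd_congr i g h ?_)
    have e' : φ g = φ h := congrArg Subtype.val e
    have := hker (g - h) (by rw [map_sub, e', sub_self])
    filter_upwards [this] with z hz
    exact sub_eq_zero.1 hz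
  refine ⟨Derivation.mk' { toFun := fun x => φ.rangeRestrict (pd i (s x))
                           map_add' := fun x y => ?_
                           map_smul' := fun c x => ?_ } fun x y => ?_, fun g => ?_⟩
  · rw [← map_add, ← hc _ _ (pd_add i (s x) (s y))]
    exact key _ _ (by rw [map_add, hs, hs, hs])
  · rw [RingHom.id_apply, ← map_smul, ← hc _ _ (pd_smul i c (s x))]
    exact key _ _ (by rw [map_smul, hs, hs])
  · change φ.rangeRestrict (pd i (s (x * y))) = x * φ.rangeRestrict (pd i (s y)) +
      y * φ.rangeRestrict (pd i (s x))
    rw [key (s (x * y)) (s x * s y) (by rw [map_mul, hs, hs, hs]), hc _ _ (pd_mul i (s x) (s y)),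
      map_add, map_mul, map_mul, hs, hs]
  · exact key _ _ (by rw [hs])

theorem base_case (φ : R n →ₐ[ℂ] L) (hφ : Germy φ)
    (hker : ∀ g : R n, φ g = 0 → ∀ᶠ z in 𝓝 (0 : Fin n → ℂ), g.1 z = 0)
    (halg : Algebra.IsAlgebraic φ.range L) (a : L)
    (ha : ∀ D : Derivation ℂ L L, IsDer φ D → D a = 0) : ∃ c : ℂ, a = algebraMap ℂ L c := by
  choose δ hδ using exists_delta φ hφ hker
  let _ : Algebra (FractionRing φ.range) L := FractionRing.liftAlgebra φ.range L
  have : IsScalarTower φ.range (FractionRing φ.range) L :=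
    FractionRing.isScalarTower_liftAlgebra φ.range L
  have : IsScalarTower ℂ (FractionRing φ.range) L := IsScalarTower.of_algebraMap_eq fun c => by
    rw [IsScalarTower.algebraMap_apply ℂ φ.range (FractionRing φ.range),
      ← IsScalarTower.algebraMap_apply φ.range (FractionRing φ.range) L]
    rfl
  have : Algebra.IsAlgebraic (FractionRing φ.range) L :=
    Algebra.IsAlgebraic.extendScalars (IsFractionRing.injective φ.range (FractionRing φ.range))
  refine const_of_der (FractionRing φ.range) δ ?_ a ?_
  · intro u v hv h
    obtain ⟨u, rfl⟩ := φ.rangeRestrict_surjective u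
    obtain ⟨v, rfl⟩ := φ.rangeRestrict_surjective v
    obtain ⟨c, hc⟩ := germ_const u v (fun h0 => hv (Subtype.ext (hφ v h0))) fun i => by
      have := h i
      rw [hδ, hδ, ← map_mul, ← map_mul] at this
      have e' := congrArg Subtype.val this
      have := hker (pd i u * v - u * pd i v) (by rw [map_sub]; exact sub_eq_zero.2 e')
      filter_upwards [this] with z hz
      exact sub_eq_zero.1 hz
    refine ⟨c, ?_⟩
    rw [← AlgHom.commutes φ.rangeRestrict c, ← map_mul]
    exact Subtype.ext (hφ.congr hc)
  · intro i D hD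
    have hD' : ∀ g, D (φ g) = φ (pd i g) := fun g => by
      have := hD (φ.rangeRestrict g)
      rw [hδ] at this
      exact this
    refine ha D fun g => ?_
    rw [hD', Finset.sum_eq_single i]
    · rw [hD', pd_coord]; simp
    · intro j _ hj
      rw [hD', pd_coord, if_neg hj]; simp
    · simp

end

section
variable {n : ℕ} {L : Type*} [Field L] [Algebra ℂ L]

theorem Germy.comp_lsub {m : ℕ} {φ : R n →ₐ[ℂ] L} (hφ : Germy φ)
    (T : (Fin n → ℂ) →L[ℂ] (Fin m → ℂ)) : Germy (φ.comp (lsub T)) := by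
  intro g hg
  have ht : Tendsto T (𝓝 0) (𝓝 0) := by simpa using T.continuous.tendsto 0
  exact hφ _ (ht.eventually hg)

theorem lsub_coord {m : ℕ} (T : (Fin n → ℂ) →L[ℂ] (Fin m → ℂ)) (j : Fin m) :
    lsub T (coord j) = ∑ i, (T (Pi.single i 1) j) • coord i := by
  ext z
  change ((ContinuousLinearMap.proj (R := ℂ) (φ := fun _ : Fin m => ℂ) j).comp T) z = _
  rw [fderiv_expand]
  simp [coord, mul_comm]

theorem IsDer.comp_lsub {m : ℕ} {φ : R n →ₐ[ℂ] L} (hφ : Germy φ) {D : Derivation ℂ L L}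
    (hD : IsDer φ D) (T : (Fin n → ℂ) →L[ℂ] (Fin m → ℂ)) : IsDer (φ.comp (lsub T)) D := by
  intro g
  have h1 : ∀ i, φ (pd i (lsub T g)) =
      ∑ j, (T (Pi.single i 1) j) • φ (lsub T (pd j g)) := fun i => by
    rw [hφ.congr (pd_lsub T i g), map_sum]
    simp only [map_smul]
  have h2 : ∀ j, D (φ (lsub T (coord j))) = ∑ i, (T (Pi.single i 1) j) • D (φ (coord i)) :=
    fun j => by
      rw [lsub_coord, map_sum, map_sum]
      simp only [map_smul, D.map_smul]
  change D (φ (lsub T g)) = ∑ j, φ (lsub T (pd j g)) * D (φ (lsub T (coord j)))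
  rw [hD (lsub T g)]
  simp only [h1, h2, Finset.sum_mul, Finset.mul_sum]
  rw [Finset.sum_comm]
  refine Finset.sum_congr rfl fun j _ => Finset.sum_congr rfl fun i _ => ?_
  rw [smul_mul_assoc, mul_smul_comm]

theorem lsub_symm (φ : R n →ₐ[ℂ] L) (T : (Fin n → ℂ) ≃L[ℂ] (Fin n → ℂ)) :
    (φ.comp (lsub (T : (Fin n → ℂ) →L[ℂ] (Fin n → ℂ)))).comp
      (lsub (T.symm : (Fin n → ℂ) →L[ℂ] (Fin n → ℂ))) = φ := by
  ext g
  change φ (lsub _ (lsub _ g)) = φ g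
  congr 1
  ext z
  change g.1 (T.symm (T z)) = g.1 z
  simp

/-- tail as a continuous linear map -/
noncomputable def tailL (n : ℕ) : (Fin (n + 1) → ℂ) →L[ℂ] (Fin n → ℂ) :=
  ContinuousLinearMap.pi fun i => ContinuousLinearMap.proj (R := ℂ) (φ := fun _ => ℂ) i.succ

theorem division (φ : R (n + 1) →ₐ[ℂ] L) (hφ : Germy φ) (h : R (n + 1))
    (hne : ¬ ∀ᶠ t in 𝓝 (0 : ℂ), h.1 (Fin.cons t 0) = 0) : ∃ d : ℕ, (∀ g : R (n + 1),
      ∃ (q : R (n + 1)) (r : ℕ → R n), (∀ᶠ z in 𝓝 (0 : Fin (n + 1) → ℂ), g.1 z =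
        (q * h + ∑ j ∈ Finset.range d, lsub (tailL n) (r j) * coord 0 ^ j).1 z) ∧
        (g = coord 0 ^ d → φ q ≠ 0)) := by
  obtain ⟨d, hd⟩ := weierstrass n h.1 (R_mem h) hne
  refine ⟨d, fun g => ?_⟩
  obtain ⟨q, r, hq, hr, he, hq0⟩ := hd g.1 (R_mem g)
  refine ⟨⟨q, hq⟩, fun j => ⟨r j, hr j⟩, ?_, fun hg => hφ.ne_zero _ (hq0 fun z => ?_)⟩
  · filter_upwards [he] with z hz
    rw [hz]
    simp
    rfl
  · rw [hg]; rfl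

/-- defect of the chain rule -/
noncomputable def defect (φ : R n →ₐ[ℂ] L) (D : Derivation ℂ L L) (g : R n) : L :=
  D (φ g) - ∑ i, φ (pd i g) * D (φ (coord i))

theorem defect_congr {φ : R n →ₐ[ℂ] L} (hφ : Germy φ) (D : Derivation ℂ L L) {g h : R n}
    (e : ∀ᶠ z in 𝓝 (0 : Fin n → ℂ), g.1 z = h.1 z) : defect φ D g = defect φ D h := by
  unfold defect
  rw [hφ.congr e]
  simp only [hφ.congr (pd_congr _ g h e)]

theorem defect_add {φ : R n →ₐ[ℂ] L} (hφ : Germy φ) (D : Derivation ℂ L L) (g h : R n) :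
    defect φ D (g + h) = defect φ D g + defect φ D h := by
  unfold defect
  simp only [hφ.congr (pd_add _ g h), map_add, add_mul, Finset.sum_add_distrib]
  ring

theorem defect_mul {φ : R n →ₐ[ℂ] L} (hφ : Germy φ) (D : Derivation ℂ L L) (g h : R n) :
    defect φ D (g * h) = φ g * defect φ D h + φ h * defect φ D g := by
  unfold defect
  simp only [hφ.congr (pd_mul _ g h), map_add, map_mul, add_mul, Finset.sum_add_distrib,
    Derivation.leibniz, smul_eq_mul, mul_assoc, ← Finset.mul_sum]
  ring

theorem defect_one {φ : R n →ₐ[ℂ] L} (D : Derivation ℂ L L) : defect φ D 1 = 0 := by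
  have : ∀ i : Fin n, pd i (1 : R n) = 0 := fun i => by
    simpa using pd_const (n := n) i 1
  simp [defect, this]

theorem defect_coord {φ : R n →ₐ[ℂ] L} (D : Derivation ℂ L L) (j : Fin n) :
    defect φ D (coord j) = 0 := by
  simp [defect, pd_coord, apply_ite φ]

theorem defect_pow {φ : R n →ₐ[ℂ] L} (hφ : Germy φ) (D : Derivation ℂ L L) (g : R n)
    (hg : defect φ D g = 0) (j : ℕ) : defect φ D (g ^ j) = 0 := by
  induction j with
  | zero => rw [pow_zero, defect_one]
  | succ j ih => rw [pow_succ, defect_mul hφ, ih, hg]; simp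

theorem defect_sum {φ : R n →ₐ[ℂ] L} (hφ : Germy φ) (D : Derivation ℂ L L) (s : Finset ℕ)
    (g : ℕ → R n) : defect φ D (∑ j ∈ s, g j) = ∑ j ∈ s, defect φ D (g j) :=
  map_sum (AddMonoidHom.mk' (defect φ D) (defect_add hφ D)) g s

theorem defect_tail {φ : R (n + 1) →ₐ[ℂ] L} (hφ : Germy φ) (D : Derivation ℂ L L)
    (hD : IsDer (φ.comp (lsub (tailL n))) D) (r : R n) :
    defect φ D (lsub (tailL n) r) = 0 := by
  unfold defect
  rw [sub_eq_zero]
  have h1 := hD r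
  have h2 : ∀ j : Fin n, lsub (tailL n) (coord j) = coord j.succ := fun j => rfl
  simp only [AlgHom.comp_apply, h2] at h1
  rw [h1, Fin.sum_univ_succ]
  have h3 : ∀ i, φ (pd i (lsub (tailL n) r)) =
      ∑ j, (tailL n (Pi.single i 1) j) • φ (lsub (tailL n) (pd j r)) := fun i => by
    rw [hφ.congr (pd_lsub (tailL n) i r), map_sum]
    simp only [map_smul]
  simp only [h3]
  have h4 : ∀ i j, tailL n (Pi.single i 1) j = if j.succ = i then 1 else 0 := fun i j => by
    change (Pi.single i 1 : Fin (n + 1) → ℂ) j.succ = _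
    rw [Pi.single_apply]
  simp [h4]

theorem step_der (φ : R (n + 1) →ₐ[ℂ] L) (hφ : Germy φ) (h : R (n + 1)) (hh : φ h = 0)
    (hne : ¬ ∀ᶠ t in 𝓝 (0 : ℂ), h.1 (Fin.cons t 0) = 0) (D : Derivation ℂ L L)
    (hD : IsDer (φ.comp (lsub (tailL n))) D) : IsDer φ D := by
  obtain ⟨d, hd⟩ := division φ hφ h hne
  have hsum : ∀ r : ℕ → R n,
      defect φ D (∑ j ∈ Finset.range d, lsub (tailL n) (r j) * coord 0 ^ j) = 0 := fun r => by
    rw [defect_sum hφ]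
    refine Finset.sum_eq_zero fun j _ => ?_
    rw [defect_mul hφ, defect_tail hφ D hD, defect_pow hφ D _ (defect_coord D 0)]
    simp
  have hz : defect φ D h = 0 := by
    obtain ⟨q, r, he, hq⟩ := hd (coord 0 ^ d)
    have := defect_congr hφ D he
    rw [defect_pow hφ D _ (defect_coord D 0), defect_add hφ, hsum, defect_mul hφ, hh] at this
    simpa [hq rfl] using this
  intro g
  obtain ⟨q, r, he, -⟩ := hd g
  have := defect_congr hφ D he
  rw [defect_add hφ, hsum, defect_mul hφ, hh, hz] at this
  simp only [mul_zero, zero_mul, add_zero] at this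
  exact sub_eq_zero.1 this

theorem step_alg (φ : R (n + 1) →ₐ[ℂ] L) (hφ : Germy φ) (h : R (n + 1)) (hh : φ h = 0)
    (hne : ¬ ∀ᶠ t in 𝓝 (0 : ℂ), h.1 (Fin.cons t 0) = 0)
    (halg : Algebra.IsAlgebraic φ.range L) :
    Algebra.IsAlgebraic (φ.comp (lsub (tailL n))).range L := by
  obtain ⟨d, hd⟩ := division φ hφ h hne
  set ψ := φ.comp (lsub (tailL n)) with hψ
  have hex : ∀ g, ∃ r : ℕ → ψ.range, φ g =
      ∑ j ∈ Finset.range d, algebraMap ψ.range L (r j) * φ (coord 0) ^ j := by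
    intro g
    obtain ⟨q, r, he, -⟩ := hd g
    refine ⟨fun j => ψ.rangeRestrict (r j), ?_⟩
    rw [hφ.congr he, map_add, map_mul, hh, mul_zero, zero_add, map_sum]
    refine Finset.sum_congr rfl fun j _ => ?_
    rw [map_mul, map_pow]
    rfl
  have hx : IsIntegral ψ.range (φ (coord 0)) := by
    obtain ⟨r, hr⟩ := hex (coord 0 ^ d)
    let Q : Polynomial ψ.range := ∑ j ∈ Finset.range d, Polynomial.monomial j (r j)
    have hQ : Q.degree < d := by
      refine (Polynomial.degree_sum_le _ _).trans_lt ?_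
      rw [Finset.sup_lt_iff (WithBot.bot_lt_coe _)]
      intro j hj
      refine (Polynomial.degree_monomial_le _ _).trans_lt ?_
      exact_mod_cast Finset.mem_range.1 hj
    refine ⟨Polynomial.X ^ d - Q, Polynomial.monic_X_pow_sub hQ, ?_⟩
    rw [← Polynomial.aeval_def, map_sub, map_pow, Polynomial.aeval_X, ← map_pow, hr, sub_eq_zero]
    simp only [Q, map_sum, Polynomial.aeval_monomial]
  have hInteg : ∀ g, IsIntegral ψ.range (φ g) := by
    intro g
    obtain ⟨r, hr⟩ := hex g
    rw [hr]
    exact IsIntegral.sum _ fun j _ => isIntegral_algebraMap.mul (hx.pow j)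
  have hle : ψ.range ≤ φ.range := by
    rintro _ ⟨g, rfl⟩
    exact ⟨_, rfl⟩
  let _ : Algebra ψ.range φ.range := (Subalgebra.inclusion hle).toAlgebra
  have : IsScalarTower ψ.range φ.range L := IsScalarTower.of_algebraMap_eq fun x => rfl
  have : Algebra.IsIntegral ψ.range φ.range := ⟨fun x => by
    obtain ⟨g, rfl⟩ := φ.rangeRestrict_surjective x
    have h1 : IsIntegral ψ.range (algebraMap φ.range L (φ.rangeRestrict g)) := hInteg g
    exact (isIntegral_algebraMap_iff Subtype.val_injective).1 h1⟩
  have : Algebra.IsAlgebraic ψ.range φ.range := ⟨fun x =>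
    (Algebra.IsIntegral.isIntegral (R := ψ.range) x).isAlgebraic⟩
  exact Algebra.IsAlgebraic.trans ψ.range φ.range L

end

theorem exists_line {n : ℕ} (h : R n) (h0 : h.1 0 = 0)
    (hne : ¬ ∀ᶠ z in 𝓝 (0 : Fin n → ℂ), h.1 z = 0) :
    ∃ v : Fin n → ℂ, v ≠ 0 ∧ ¬ ∀ᶠ t in 𝓝 (0 : ℂ), h.1 (t • v) = 0 := by
  obtain ⟨r, hr, hB⟩ := Metric.eventually_nhds_iff_ball.1 (R_mem h).eventually_analyticAt
  obtain ⟨v, hv, hvB⟩ :=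
    ((not_eventually.1 hne).and_eventually (Metric.ball_mem_nhds 0 hr)).exists
  refine ⟨v, fun h' => hv (by rw [h', h0]), fun hev => hv ?_⟩
  let l : ℂ →L[ℂ] (Fin n → ℂ) := ContinuousLinearMap.toSpanSingleton ℂ v
  let S : Set ℂ := l ⁻¹' Metric.ball 0 r
  have hS : Convex ℝ S := (convex_ball (0 : Fin n → ℂ) r).linear_preimage
    ((l : ℂ →ₗ[ℂ] (Fin n → ℂ)).restrictScalars ℝ)
  have han : AnalyticOnNhd ℂ (fun t => h.1 (l t)) S := fun t ht =>
    AnalyticAt.fun_comp (g := h.1) (hB _ ht) (l.analyticAt t)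
  have h0S : (0 : ℂ) ∈ S := by simp [S, hr]
  have h1S : (1 : ℂ) ∈ S := by simpa [S, l] using hvB
  have := han.eqOn_zero_of_preconnected_of_eventuallyEq_zero hS.isPreconnected h0S
    (show ∀ᶠ t in 𝓝 (0 : ℂ), h.1 (l t) = 0 by simpa [l] using hev) h1S
  simpa [l] using this

theorem main_claim (n : ℕ) {L : Type*} [Field L] [Algebra ℂ L] (φ : R n →ₐ[ℂ] L) (hφ : Germy φ)
    (halg : Algebra.IsAlgebraic φ.range L) (a : L)
    (ha : ∀ D : Derivation ℂ L L, IsDer φ D → D a = 0) : ∃ c : ℂ, a = algebraMap ℂ L c := by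
  induction n with
  | zero =>
    refine base_case φ hφ (fun g hg => ?_) halg a ha
    by_contra hne
    refine hφ.ne_zero g (fun h0 => hne (Eventually.of_forall fun z => ?_)) hg
    rw [Subsingleton.elim z 0, h0]
  | succ n ih =>
    by_cases hker : ∀ g : R (n + 1), φ g = 0 → ∀ᶠ z in 𝓝 (0 : Fin (n + 1) → ℂ), g.1 z = 0
    · exact base_case φ hφ hker halg a ha
    push Not at hker
    obtain ⟨h, hh, hne⟩ := hker
    have h0 : h.1 0 = 0 := by
      by_contra h0
      exact hφ.ne_zero h h0 hh
    obtain ⟨v, hv, hline⟩ := exists_line h h0 (not_eventually.2 hne)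
    obtain ⟨T, hT⟩ := SeparatingDual.exists_continuousLinearEquiv_apply_eq (R := ℂ)
      (x := v) (y := (Fin.cons 1 0 : Fin (n + 1) → ℂ)) hv (fun h => by
        simpa using congrFun h 0)
    set ψ := φ.comp (lsub (T : (Fin (n + 1) → ℂ) →L[ℂ] (Fin (n + 1) → ℂ))) with hψ
    have hψφ : ψ.comp (lsub (T.symm : (Fin (n + 1) → ℂ) →L[ℂ] (Fin (n + 1) → ℂ))) = φ :=
      lsub_symm φ T
    have hψg : Germy ψ := hφ.comp_lsub _
    let k := lsub (T.symm : (Fin (n + 1) → ℂ) →L[ℂ] (Fin (n + 1) → ℂ)) h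
    have hk : ψ k = 0 := by
      rw [← hh]; exact DFunLike.congr_fun hψφ h
    have hkl : ¬ ∀ᶠ t in 𝓝 (0 : ℂ), k.1 (Fin.cons t 0) = 0 := by
      intro hev
      refine hline (hev.mono fun t ht => ?_)
      rw [← ht]
      change h.1 (t • v) = h.1 (T.symm (Fin.cons t 0))
      refine congrArg h.1 ?_
      rw [ContinuousLinearEquiv.eq_symm_apply, map_smul, hT]
      ext i
      refine Fin.cases ?_ (fun i => ?_) i <;> simp
    have hrange : ψ.range = φ.range := by
      apply le_antisymm
      · rintro _ ⟨g, rfl⟩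
        exact ⟨_, rfl⟩
      · rintro _ ⟨g, rfl⟩
        exact ⟨_, DFunLike.congr_fun hψφ g⟩
    have halgψ : Algebra.IsAlgebraic ψ.range L := by rw [hrange]; exact halg
    refine ih (ψ.comp (lsub (tailL n))) (hψg.comp_lsub _) (step_alg ψ hψg k hk hkl halgψ)
      fun D hD => ha D ?_
    have h1 : IsDer ψ D := step_der ψ hψg k hk hkl D hD
    have h2 := h1.comp_lsub hψg (T.symm : (Fin (n + 1) → ℂ) →L[ℂ] (Fin (n + 1) → ℂ))
    rwa [hψφ] at h2

/-- germs vanishing along an ultrafilter -/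
def ufIdeal {n : ℕ} (l : Ultrafilter (Fin n → ℂ)) : Ideal (R n) where
  carrier := {g | ∀ᶠ z in (l : Filter (Fin n → ℂ)), g.1 z = 0}
  add_mem' := fun {a b} ha hb => by
    filter_upwards [ha, hb] with z h1 h2
    change a.1 z + b.1 z = 0
    rw [h1, h2, add_zero]
  zero_mem' := Eventually.of_forall fun _ => rfl
  smul_mem' := fun c x hx => by
    filter_upwards [hx] with z h1
    change c.1 z * x.1 z = 0
    rw [h1, mul_zero]

theorem mem_ufIdeal {n : ℕ} (l : Ultrafilter (Fin n → ℂ)) (g : R n) :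
    g ∈ ufIdeal l ↔ ∀ᶠ z in (l : Filter (Fin n → ℂ)), g.1 z = 0 := Iff.rfl

theorem ufIdeal_prime {n : ℕ} (l : Ultrafilter (Fin n → ℂ)) : (ufIdeal l).IsPrime where
  ne_top' := by
    rw [Ne, Ideal.eq_top_iff_one, mem_ufIdeal]
    intro h
    obtain ⟨z, hz⟩ := h.exists
    exact one_ne_zero (α := ℂ) hz
  mem_or_mem' := fun {x y} h => by
    rw [mem_ufIdeal] at h
    simp only [mem_ufIdeal]
    rw [← Ultrafilter.eventually_or]
    filter_upwards [h] with z hz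
    exact mul_eq_zero.1 hz

theorem alg_of_frac {n : ℕ} {L : Type*} [Field L] [Algebra ℂ L] (φ : R n →ₐ[ℂ] L)
    (hfrac : ∀ a, ∃ u v, a = φ u / φ v) : Algebra.IsAlgebraic φ.range L := ⟨fun a => by
  obtain ⟨u, v, rfl⟩ := hfrac a
  have hu : IsAlgebraic φ.range (φ u) := isAlgebraic_algebraMap (φ.rangeRestrict u)
  have hv : IsAlgebraic φ.range (φ v) := isAlgebraic_algebraMap (φ.rangeRestrict v)
  rw [div_eq_mul_inv]
  exact hu.mul hv.inv⟩

theorem exists_field {S : Type} [CommRing S] [Algebra ℂ S] (P : Ideal S) [P.IsPrime] :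
    ∃ (L : Type) (_ : Field L) (_ : Algebra ℂ L) (φ : S →ₐ[ℂ] L),
      (∀ g, φ g = 0 ↔ g ∈ P) ∧ ∀ a, ∃ u v, a = φ u / φ v := by
  refine ⟨FractionRing (S ⧸ P), inferInstance, inferInstance,
    (IsScalarTower.toAlgHom ℂ (S ⧸ P) (FractionRing (S ⧸ P))).comp (Ideal.Quotient.mkₐ ℂ P),
    fun g => ?_, fun a => ?_⟩
  · rw [← Ideal.Quotient.eq_zero_iff_mem]
    exact map_eq_zero_iff (algebraMap (S ⧸ P) (FractionRing (S ⧸ P)))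
      (IsFractionRing.injective (S ⧸ P) (FractionRing (S ⧸ P)))
  · obtain ⟨u, v, -, rfl⟩ := IsFractionRing.div_surjective (A := S ⧸ P) a
    obtain ⟨u, rfl⟩ := Ideal.Quotient.mk_surjective u
    obtain ⟨v, rfl⟩ := Ideal.Quotient.mk_surjective v
    exact ⟨u, v, rfl⟩

theorem const_along {n : ℕ} (l : Ultrafilter (Fin n → ℂ)) (hl : (l : Filter (Fin n → ℂ)) ≤ 𝓝 0)
    (f : R n) (hf : ∀ i, ∀ᶠ z in (l : Filter (Fin n → ℂ)), (pd i f).1 z = 0) :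
    ∃ c : ℂ, ∀ᶠ z in (l : Filter (Fin n → ℂ)), f.1 z = c := by
  have := ufIdeal_prime l
  obtain ⟨L, _, _, φ, hφ0, hfrac⟩ := exists_field (ufIdeal l)
  have hφ : Germy φ := fun g hg => (hφ0 g).2 (hl hg)
  obtain ⟨c, hc⟩ := main_claim n φ hφ (alg_of_frac φ hfrac) (φ f) fun D hD => by
    rw [hD f]
    exact Finset.sum_eq_zero fun i _ => by rw [(hφ0 _).2 (hf i), zero_mul]
  refine ⟨c, ?_⟩
  have h1 : φ (f - algebraMap ℂ (R n) c) = 0 := by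
    rw [map_sub, AlgHom.commutes, hc, sub_self]
  filter_upwards [(hφ0 _).1 h1] with z hz
  exact sub_eq_zero.1 hz

theorem germ_main {n : ℕ} (f : (Fin n → ℂ) → ℂ) (hf : AnalyticAt ℂ f 0) (hf0 : f 0 = 0) :
    ∀ᶠ z in 𝓝 (0 : Fin n → ℂ), fderiv ℂ f z = 0 → f z = 0 := by
  by_contra hne
  have hfr : ∃ᶠ z in 𝓝 (0 : Fin n → ℂ), fderiv ℂ f z = 0 ∧ f z ≠ 0 := by
    refine (not_eventually.1 hne).mono fun z hz => ?_
    push Not at hz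
    exact hz
  have hnb : (𝓝 (0 : Fin n → ℂ) ⊓ 𝓟 {z | fderiv ℂ f z = 0 ∧ f z ≠ 0}).NeBot :=
    frequently_mem_iff_neBot.1 hfr
  let l := Ultrafilter.of (𝓝 (0 : Fin n → ℂ) ⊓ 𝓟 {z | fderiv ℂ f z = 0 ∧ f z ≠ 0})
  have hl := Ultrafilter.of_le (𝓝 (0 : Fin n → ℂ) ⊓ 𝓟 {z | fderiv ℂ f z = 0 ∧ f z ≠ 0})
  have hl0 : (l : Filter (Fin n → ℂ)) ≤ 𝓝 0 := hl.trans inf_le_left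
  have hl1 : ∀ᶠ z in (l : Filter (Fin n → ℂ)), fderiv ℂ f z = 0 ∧ f z ≠ 0 :=
    le_principal_iff.1 (hl.trans inf_le_right)
  obtain ⟨c, hc⟩ := const_along l hl0 ⟨f, hf⟩ fun i => by
    filter_upwards [hl1] with z hz
    change fderiv ℂ f z _ = 0
    rw [hz.1]; rfl
  have ht : Tendsto f l (𝓝 0) := by
    have := hf.continuousAt.tendsto
    rw [hf0] at this
    exact this.mono_left hl0
  have ht2 : Tendsto f l (𝓝 c) := tendsto_const_nhds.congr' (by
    filter_upwards [hc] with z hz using hz.symm)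
  have hc0 : c = 0 := tendsto_nhds_unique ht2 ht
  obtain ⟨z, hz1, hz2⟩ := (hl1.and hc).exists
  exact hz1.2 (hz2.trans hc0)

end CritLocus

/-- For a complex analytic function `f` on an open set `U ⊆ ℂ^(n+1)` containing the
origin with `f 0 = 0`, there is an open neighborhood `W ⊆ U` of the origin on which
the critical locus of `f` is contained in the hypersurface `V(f)`. -/
theorem criticalLocus_subset_hypersurface_near_origin (n : ℕ)
    (U : Set (Fin (n + 1) → ℂ)) (hU : IsOpen U) (h0U : (0 : Fin (n + 1) → ℂ) ∈ U)
    (f : (Fin (n + 1) → ℂ) → ℂ) (hf : AnalyticOnNhd ℂ f U) (hf0 : f 0 = 0) :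
    ∃ W : Set (Fin (n + 1) → ℂ), IsOpen W ∧ (0 : Fin (n + 1) → ℂ) ∈ W ∧ W ⊆ U ∧
      ∀ z ∈ W, fderiv ℂ f z = 0 → f z = 0 := by
  have h1 := CritLocus.germ_main f (hf 0 h0U) hf0
  obtain ⟨V, hV, hVo, h0V⟩ := eventually_nhds_iff.1 h1
  exact ⟨V ∩ U, hVo.inter hU, ⟨h0V, h0U⟩, Set.inter_subset_right, fun z hz => hV z hz.1⟩
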